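/- Let U ⊆ ℂ⁴ be open with complex coordinates (z¹, z², w¹, w²) and let Θ : U → ℂ be holomorphic. Write Θ_{αβ} := ∂²Θ/∂w^α ∂w^β, and suppose Θ satisfies Plebanski's second heavenly equation on U: ∂²Θ/∂z¹∂w² − ∂²Θ/∂z²∂w¹ + (Θ_{12})² − Θ_{11}·Θ_{22} = 0. For (λ₁, λ₂) ∈ ℂ² define the first-order differential operators acting on holomorphic functions f : U → ℂ by L₁f := −λ₁·∂f/∂w¹ + λ₂·(∂f/∂z¹ + Θ_{12}·∂f/∂w¹ − Θ_{11}·∂f/∂w²) and L₂f := −λ₁·∂f/∂w² + λ₂·(∂f/∂z² + Θ_{22}·∂f/∂w¹ − Θ_{12}·∂f/∂w²). Then the Lax pair commutes: for every holomorphic f : U → ℂ and every (λ₁, λ₂) ∈ ℂ², L₁(L₂f) = L₂(L₁f) on U. -/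

import Mathlib

/-- The holomorphic partial derivative of `f : ℂ⁴ → ℂ` in the `i`-th coordinate
direction. -/
noncomputable def pd (i : Fin 4) (f : (Fin 4 → ℂ) → ℂ) (x : Fin 4 → ℂ) : ℂ :=
  fderiv ℂ f x (Pi.single i 1)

/-- The first Lax operator
`L₁ f = -λ₁ ∂f/∂w¹ + λ₂ (∂f/∂z¹ + Θ_{12} ∂f/∂w¹ − Θ_{11} ∂f/∂w²)` associated with the
second Plebanski scalar `Θ`.  Coordinates on `ℂ⁴`: `z¹, z², w¹, w²` are indexed by
`0, 1, 2, 3`, and `Θ_{αβ} = ∂²Θ/∂w^α ∂w^β`. -/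
noncomputable def secondLax1 (Θ : (Fin 4 → ℂ) → ℂ) (l1 l2 : ℂ) (f : (Fin 4 → ℂ) → ℂ) :
    (Fin 4 → ℂ) → ℂ :=
  fun x => -l1 * pd 2 f x +
    l2 * (pd 0 f x + pd 3 (pd 2 Θ) x * pd 2 f x - pd 2 (pd 2 Θ) x * pd 3 f x)

/-- The second Lax operator
`L₂ f = -λ₁ ∂f/∂w² + λ₂ (∂f/∂z² + Θ_{22} ∂f/∂w¹ − Θ_{12} ∂f/∂w²)`. -/
noncomputable def secondLax2 (Θ : (Fin 4 → ℂ) → ℂ) (l1 l2 : ℂ) (f : (Fin 4 → ℂ) → ℂ) :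
    (Fin 4 → ℂ) → ℂ :=
  fun x => -l1 * pd 3 f x +
    l2 * (pd 1 f x + pd 3 (pd 3 Θ) x * pd 2 f x - pd 3 (pd 2 Θ) x * pd 3 f x)

open Metric Filter Topology MeasureTheory in
/-- A directional derivative of a holomorphic function on an open subset of a finite-dimensional
complex space is holomorphic. -/
theorem differentiableOn_fderiv_apply {E : Type*} [NormedAddCommGroup E] [NormedSpace ℂ E]
    [FiniteDimensional ℂ E] {U : Set E} (hU : IsOpen U) {f : E → ℂ}
    (hf : DifferentiableOn ℂ f U) (v : E) : DifferentiableOn ℂ (fun x => fderiv ℂ f x v) U := by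
  borelize E
  intro x₀ hx₀
  obtain ⟨R, hR, hRU⟩ : ∃ R > 0, ∀ y ∈ ball x₀ (3 * R), y ∈ U ∧ dist (f y) (f x₀) < 1 := by
    have h : ∀ᶠ y in 𝓝 x₀, y ∈ U ∧ dist (f y) (f x₀) < 1 :=
      Filter.Eventually.and (hU.mem_nhds hx₀) ((hf.continuousOn.continuousAt (hU.mem_nhds hx₀)).eventually
        (ball_mem_nhds (f x₀) one_pos))
    obtain ⟨ε, hε, h⟩ := eventually_nhds_iff_ball.1 h
    exact ⟨ε / 3, by positivity, fun y hy => h y (by convert hy using 2; ring)⟩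
  have hfat : ∀ y ∈ ball x₀ (3 * R), DifferentiableAt ℂ f y := fun y hy =>
    hf.differentiableAt (hU.mem_nhds (hRU y hy).1)
  have hbound : ∀ y ∈ ball x₀ (2 * R), ‖fderiv ℂ f y‖ ≤ 2 / R := by
    intro y hy
    have hsub : ball y R ⊆ ball x₀ (3 * R) := ball_subset_ball' (by
      rw [mem_ball] at hy; linarith)
    refine Complex.norm_fderiv_le_div_of_mapsTo_ball
      (fun z hz => (hfat z (hsub hz)).differentiableWithinAt) (fun z hz => ?_) hR
    have h1 := (hRU z (hsub hz)).2
    have h2 := (hRU y (hsub (mem_ball_self hR))).2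
    rw [mem_closedBall]
    linarith [dist_triangle_right (f z) (f y) (f x₀)]
  set r : ℝ := R / (‖v‖ + 1) with hr
  have hr0 : 0 < r := by positivity
  have hrv : r * ‖v‖ < R := by
    rw [hr, div_mul_eq_mul_div, div_lt_iff₀ (by positivity)]
    nlinarith
  have hmem : ∀ x ∈ ball x₀ R, ∀ z ∈ closedBall (0 : ℂ) r, x + z • v ∈ ball x₀ (2 * R) := by
    intro x hx z hz
    rw [mem_ball, dist_eq_norm] at hx ⊢
    rw [mem_closedBall_zero_iff] at hz
    calc ‖x + z • v - x₀‖ = ‖(x - x₀) + z • v‖ := by congr 1; abel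
      _ ≤ ‖x - x₀‖ + ‖z‖ * ‖v‖ := (norm_add_le _ _).trans_eq (by rw [norm_smul])
      _ < 2 * R := by nlinarith [norm_nonneg v]
  have hsub : ball x₀ (2 * R) ⊆ ball x₀ (3 * R) := ball_subset_ball (by linarith)
  have hcirc : ∀ t : ℝ, circleMap 0 r t ∈ closedBall (0 : ℂ) r :=
    fun t => circleMap_mem_closedBall 0 hr0.le t
  -- the kernel of the Cauchy integral formula for the derivative, parametrised by the angle
  set k : ℝ → ℂ := fun t => deriv (circleMap 0 r) t * (1 / (circleMap 0 r t - 0) ^ 2) with hk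
  have hkc : Continuous k := by
    simp only [hk, deriv_circleMap]
    refine ((continuous_circleMap 0 r).mul continuous_const).mul
      (continuous_const.div (by fun_prop) fun t => ?_)
    simpa using hr0.ne'
  have hcauchy : ∀ x ∈ ball x₀ R,
      ∫ t in (0 : ℝ)..2 * Real.pi, k t * f (x + circleMap 0 r t • v) =
        (2 * Real.pi * Complex.I) * fderiv ℂ f x v := by
    intro x hx
    have hline : ∀ z : ℂ, HasDerivAt (fun z : ℂ => x + z • v) v z := fun z => by
      simpa using ((hasDerivAt_id z).smul_const v).const_add x
    have hd : DifferentiableOn ℂ (fun z : ℂ => f (x + z • v)) (closedBall 0 r) := fun z hz =>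
      ((hfat _ (hsub (hmem x hx z hz))).comp z
        (hline z).differentiableAt).differentiableWithinAt
    have h0 : deriv (fun z : ℂ => f (x + z • v)) 0 = fderiv ℂ f x v := by
      have hfx : HasFDerivAt f (fderiv ℂ f x) (x + (0 : ℂ) • v) := by
        rw [zero_smul, add_zero]
        exact (hfat x (ball_subset_ball (by linarith) hx)).hasFDerivAt
      exact (hfx.comp_hasDerivAt (0 : ℂ) (hline 0)).deriv
    have := hd.deriv_eq_smul_circleIntegral hr0
    rw [h0, circleIntegral] at this
    simpa only [hk, smul_eq_mul, mul_assoc] using this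
  have hcont : ∀ x ∈ ball x₀ R, Continuous fun t => k t * f (x + circleMap 0 r t • v) := by
    intro x hx
    refine hkc.mul (continuous_iff_continuousAt.2 fun t => ?_)
    have hc : ContinuousAt f (x + circleMap 0 r t • v) :=
      (hfat _ (hsub (hmem x hx _ (hcirc t)))).continuousAt
    exact ContinuousAt.comp (f := fun t : ℝ => x + circleMap 0 r t • v) hc
      (by fun_prop)
  have hball : ball x₀ R ∈ 𝓝 x₀ := ball_mem_nhds x₀ hR
  have hderiv := intervalIntegral.hasFDerivAt_integral_of_dominated_of_fderiv_le
    (μ := volume) (a := 0) (b := 2 * Real.pi) (𝕜 := ℂ)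
    (F := fun x t => k t * f (x + circleMap 0 r t • v))
    (F' := fun x t => k t • fderiv ℂ f (x + circleMap 0 r t • v))
    (bound := fun t => ‖k t‖ * (2 / R)) hball
    (eventually_of_mem hball fun x hx => (hcont x hx).aestronglyMeasurable)
    ((hcont x₀ (mem_ball_self hR)).intervalIntegrable _ _)
    (by
      have hm : Measurable fun t : ℝ => fderiv ℂ f (x₀ + circleMap 0 r t • v) :=
        (measurable_fderiv ℂ f).comp
          (by fun_prop : Continuous fun t : ℝ => x₀ + circleMap 0 r t • v).measurable
      exact hkc.aestronglyMeasurable.smul hm.aestronglyMeasurable)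
    (Eventually.of_forall fun t _ x hx => by
      rw [norm_smul]
      exact mul_le_mul_of_nonneg_left (hbound _ (hmem x hx _ (hcirc t))) (norm_nonneg _))
    ((hkc.norm.mul continuous_const).intervalIntegrable _ _)
    (Eventually.of_forall fun t _ x hx => by
      have := (hfat _ (hsub (hmem x hx _ (hcirc t)))).hasFDerivAt
      exact ((hasFDerivAt_comp_add_right (circleMap 0 r t • v)).2 this).const_mul (k t))
  refine DifferentiableAt.differentiableWithinAt
    ((hderiv.differentiableAt.const_mul (2 * Real.pi * Complex.I)⁻¹).congr_of_eventuallyEq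
      (eventually_of_mem hball fun x hx => ?_))
  simp only [hcauchy x hx]
  rw [inv_mul_cancel_left₀ Complex.two_pi_I_ne_zero]

theorem DifferentiableOn.pd {U : Set (Fin 4 → ℂ)} {f : (Fin 4 → ℂ) → ℂ}
    (hf : DifferentiableOn ℂ f U) (hU : IsOpen U) (i : Fin 4) :
    DifferentiableOn ℂ (pd i f) U :=
  differentiableOn_fderiv_apply hU hf _

theorem pd_comm {U : Set (Fin 4 → ℂ)} (hU : IsOpen U) {f : (Fin 4 → ℂ) → ℂ}
    (hf : DifferentiableOn ℂ f U) (i j : Fin 4) {x : Fin 4 → ℂ} (hx : x ∈ U) :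
    pd i (pd j f) x = pd j (pd i f) x := by
  have hdiff : DifferentiableAt ℂ (fderiv ℂ f) x := by
    have hsum : fderiv ℂ f = fun y => ∑ i : Fin 4,
        pd i f y • (ContinuousLinearMap.proj i : (Fin 4 → ℂ) →L[ℂ] ℂ) := by
      ext y v
      nth_rewrite 1 [pi_eq_sum_univ' v]
      simp [pd, mul_comm]
    rw [hsum]
    exact DifferentiableAt.fun_sum fun i _ =>
      ((hf.pd hU i).differentiableAt (hU.mem_nhds hx)).smul_const _
  have happly : ∀ i j, pd i (pd j f) x =
      fderiv ℂ (fderiv ℂ f) x (Pi.single i 1) (Pi.single j 1) := fun i j => by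
    have := (hdiff.hasFDerivAt.clm_apply (hasFDerivAt_const (Pi.single j (1 : ℂ)) x)).fderiv
    change fderiv ℂ (fun y => fderiv ℂ f y (Pi.single j 1)) x _ = _
    rw [this]
    simp
  have hf' : ∀ᶠ y in nhds x, HasFDerivAt f (fderiv ℂ f y) y := by
    filter_upwards [hU.mem_nhds hx] with y hy
    exact (hf.differentiableAt (hU.mem_nhds hy)).hasFDerivAt
  rw [happly i j, happly j i]
  exact second_derivative_symmetric_of_eventually hf' hdiff.hasFDerivAt _ _

theorem pd_congr {U : Set (Fin 4 → ℂ)} (hU : IsOpen U) {f g : (Fin 4 → ℂ) → ℂ}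
    (h : Set.EqOn f g U) (i : Fin 4) {x : Fin 4 → ℂ} (hx : x ∈ U) : pd i f x = pd i g x := by
  rw [pd, pd, (h.eventuallyEq_of_mem (hU.mem_nhds hx)).fderiv_eq]

section Rules

variable {f g : (Fin 4 → ℂ) → ℂ} {x : Fin 4 → ℂ} (i : Fin 4)

theorem pd_add (hf : DifferentiableAt ℂ f x) (hg : DifferentiableAt ℂ g x) :
    pd i (fun y => f y + g y) x = pd i f x + pd i g x := by
  simp [pd, fderiv_fun_add hf hg]

theorem pd_sub (hf : DifferentiableAt ℂ f x) (hg : DifferentiableAt ℂ g x) :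
    pd i (fun y => f y - g y) x = pd i f x - pd i g x := by
  simp [pd, fderiv_fun_sub hf hg]

theorem pd_mul (hf : DifferentiableAt ℂ f x) (hg : DifferentiableAt ℂ g x) :
    pd i (fun y => f y * g y) x = f x * pd i g x + g x * pd i f x := by
  simp [pd, fderiv_fun_mul hf hg]

theorem pd_const_mul (c : ℂ) (hf : DifferentiableAt ℂ f x) :
    pd i (fun y => c * f y) x = c * pd i f x := by
  simp [pd, fderiv_const_mul hf]

/-- The partial derivative of an operator `-l1 ∂_c + l2 (∂_d + a ∂_2 - b ∂_3)` applied to `h`. -/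
theorem pd_lax {a b h₂ h₃ p q : (Fin 4 → ℂ) → ℂ} (l1 l2 : ℂ) (ha : DifferentiableAt ℂ a x)
    (hb : DifferentiableAt ℂ b x) (h₂' : DifferentiableAt ℂ h₂ x)
    (h₃' : DifferentiableAt ℂ h₃ x) (hp : DifferentiableAt ℂ p x)
    (hq : DifferentiableAt ℂ q x) :
    pd i (fun y => -l1 * p y + l2 * (q y + a y * h₂ y - b y * h₃ y)) x =
      -l1 * pd i p x + l2 * (pd i q x + (a x * pd i h₂ x + h₂ x * pd i a x) -
        (b x * pd i h₃ x + h₃ x * pd i b x)) := by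
  rw [pd_add i (by fun_prop) (by fun_prop), pd_const_mul i _ hp,
    pd_const_mul i _ (by fun_prop), pd_sub i (by fun_prop) (by fun_prop),
    pd_add i (by fun_prop) (by fun_prop), pd_mul i ha h₂', pd_mul i hb h₃']

end Rules

/-- If the holomorphic function `Θ` satisfies Plebanski's second heavenly equation
`∂²Θ/∂z¹∂w² − ∂²Θ/∂z²∂w¹ + (Θ_{12})² − Θ_{11} Θ_{22} = 0` on the open set `U ⊆ ℂ⁴`,
then the Lax pair commutes on every holomorphic function `f` for every value of the
spectral parameters `(λ₁, λ₂)`. -/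
theorem second_heavenly_lax_pair_commutes (U : Set (Fin 4 → ℂ)) (hU : IsOpen U)
    (Θ : (Fin 4 → ℂ) → ℂ) (hΘ : DifferentiableOn ℂ Θ U)
    (heavenly : ∀ x ∈ U,
      pd 0 (pd 3 Θ) x - pd 1 (pd 2 Θ) x + (pd 3 (pd 2 Θ) x) ^ 2 -
        pd 2 (pd 2 Θ) x * pd 3 (pd 3 Θ) x = 0)
    (f : (Fin 4 → ℂ) → ℂ) (hf : DifferentiableOn ℂ f U) (l1 l2 : ℂ) :
    ∀ x ∈ U, secondLax1 Θ l1 l2 (secondLax2 Θ l1 l2 f) x =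
      secondLax2 Θ l1 l2 (secondLax1 Θ l1 l2 f) x := by
  intro x hx
  have hat {g : (Fin 4 → ℂ) → ℂ} (hg : DifferentiableOn ℂ g U) : DifferentiableAt ℂ g x :=
    hg.differentiableAt (hU.mem_nhds hx)
  have f1 i := hat (hf.pd hU i)
  have t2 i j := hat ((hΘ.pd hU j).pd hU i)
  have hL1 : ∀ i, pd i (secondLax1 Θ l1 l2 f) x = _ := fun i =>
    pd_lax i l1 l2 (t2 3 2) (t2 2 2) (f1 2) (f1 3) (f1 2) (f1 0)
  have hL2 : ∀ i, pd i (secondLax2 Θ l1 l2 f) x = _ := fun i =>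
    pd_lax i l1 l2 (t2 3 3) (t2 3 2) (f1 2) (f1 3) (f1 3) (f1 1)
  have hheav : ∀ i, pd i (pd 0 (pd 3 Θ)) x - pd i (pd 1 (pd 2 Θ)) x +
      2 * pd 3 (pd 2 Θ) x * pd i (pd 3 (pd 2 Θ)) x -
      (pd 2 (pd 2 Θ) x * pd i (pd 3 (pd 3 Θ)) x + pd 3 (pd 3 Θ) x * pd i (pd 2 (pd 2 Θ)) x) =
        0 := fun i => by
    have h0 := pd_congr hU (g := fun _ => 0) heavenly i hx
    have hc : pd i (fun _ => 0) x = 0 := by simp [pd]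
    have d1 := t2 0 3
    have d2 := t2 1 2
    have d3 := t2 3 2
    have d4 := t2 2 2
    have d5 := t2 3 3
    simp only [pow_two] at h0
    rw [hc, pd_sub i (by fun_prop) (by fun_prop), pd_add i (by fun_prop) (by fun_prop),
      pd_sub i d1 d2, pd_mul i d3 d3, pd_mul i d4 d5] at h0
    linear_combination h0
  -- third derivatives of `Θ` do not depend on the order of differentiation
  have cΘ i j k : pd i (pd j (pd k Θ)) x = pd j (pd i (pd k Θ)) x :=
    pd_comm hU (hΘ.pd hU k) i j hx
  have cΘ' i j k : pd i (pd j (pd k Θ)) x = pd i (pd k (pd j Θ)) x :=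
    pd_congr hU (fun y hy => pd_comm hU hΘ j k hy) i hx
  have cf i j : pd i (pd j f) x = pd j (pd i f) x := pd_comm hU hf i j hx
  have h2 := hheav 2
  have h3 := hheav 3
  have e1 : pd 2 (pd 0 (pd 3 Θ)) x = pd 0 (pd 3 (pd 2 Θ)) x := by rw [cΘ, cΘ']
  have e2 : pd 2 (pd 1 (pd 2 Θ)) x = pd 1 (pd 2 (pd 2 Θ)) x := cΘ _ _ _
  have e3 : pd 3 (pd 0 (pd 3 Θ)) x = pd 0 (pd 3 (pd 3 Θ)) x := cΘ _ _ _
  have e4 : pd 3 (pd 1 (pd 2 Θ)) x = pd 1 (pd 3 (pd 2 Θ)) x := cΘ _ _ _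
  have e5 : pd 2 (pd 3 (pd 3 Θ)) x = pd 3 (pd 3 (pd 2 Θ)) x := by rw [cΘ, cΘ' 3 2 3]
  have e6 : pd 2 (pd 3 (pd 2 Θ)) x = pd 3 (pd 2 (pd 2 Θ)) x := cΘ _ _ _
  rw [e1, e2, e5, e6] at h2
  rw [e3, e4] at h3
  rw [secondLax1, secondLax2, hL2, hL2, hL2, hL1, hL1, hL1]
  rw [e5, e6, cf 0 2, cf 0 3, cf 1 2, cf 1 3, cf 0 1, cf 3 2]
  linear_combination l2 ^ 2 * (pd 2 f x * h3 - pd 3 f x * h2)
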